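/- Fix θ, σ, t > 0 and 0 ≤ a < b ≤ π. Let u : [0,π] → (Ω → ℝ) be a centered Gaussian random field with covariance E[u(x)u(y)] = Σ_{k=1}^∞ (σ²/(θπk²)) (1 − e^{−2θk²t}) sin(kx) sin(ky), and set x_j := a + (b−a)j/m. Then the estimator θ̂_{m,t} := (b−a)σ² / ( 2 Σ_{j=1}^m ( u(x_j) − u(x_{j−1}) )² ) converges in probability to θ as m → ∞. -/

import Mathlib

open MeasureTheory ProbabilityTheory Real Filter

noncomputable section

/-- `u` is a centered Gaussian random field on `S` with covariance function `C`:
every finite linear combination of its values at points of `S` is a centered real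
Gaussian with the corresponding variance. -/
def IsCenteredGaussianField {Ω : Type*} [MeasurableSpace Ω] (P : Measure Ω)
    (u : ℝ → Ω → ℝ) (S : Set ℝ) (C : ℝ → ℝ → ℝ) : Prop :=
  ∀ (n : ℕ) (x : Fin n → ℝ), (∀ i, x i ∈ S) → ∀ a : Fin n → ℝ,
    Measure.map (fun ω => ∑ i, a i * u (x i) ω) P
      = gaussianReal 0 (∑ i, ∑ j, a i * a j * C (x i) (x j)).toNNReal

/-- Spatial covariance, at a fixed time `t`, of the solution of the stochastic heat
equation `du − θΔu dt = σ dW` on `[0, π]` with zero initial and Dirichlet boundary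
conditions: `E[u(x)u(y)] = Σ_{k≥1} (σ²/(θπk²))(1 − e^{−2θk²t}) sin(kx) sin(ky)`. -/
def heatCovSpace (θ σ t x y : ℝ) : ℝ :=
  ∑' k : ℕ, (σ ^ 2 / (θ * π * ((k : ℝ) + 1) ^ 2)) *
    (1 - Real.exp (-(2 * θ * ((k : ℝ) + 1) ^ 2 * t))) *
    Real.sin (((k : ℝ) + 1) * x) * Real.sin (((k : ℝ) + 1) * y)


lemma hasSum_of_hasSum_of_eq {f g : ℕ → ℝ} {x y : ℝ} (h : HasSum f x) (hfg : ∀ k, g k = f k)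
    (hxy : y = x) : HasSum g y := by
  rw [hxy, funext hfg]
  exact h

lemma hasSum_cos_div_sq {z : ℝ} (h0 : 0 ≤ z) (h1 : z ≤ 2 * π) :
    HasSum (fun k : ℕ => Real.cos (((k : ℝ) + 1) * z) / ((k : ℝ) + 1) ^ 2)
      (π ^ 2 / 6 - π * z / 2 + z ^ 2 / 4) := by
  have hx : z / (2 * π) ∈ Set.Icc (0 : ℝ) 1 :=
    ⟨by positivity, (div_le_one (by positivity)).2 h1⟩
  have h := hasSum_one_div_nat_pow_mul_cos one_ne_zero hx
  rw [← hasSum_nat_add_iff' 1] at h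
  have hB : (Polynomial.map (algebraMap ℚ ℝ) (Polynomial.bernoulli (2 * 1))).eval (z / (2 * π))
      = (z / (2 * π)) ^ 2 - z / (2 * π) + 6⁻¹ := bernoulliFun_two _
  rw [hB] at h
  refine hasSum_of_hasSum_of_eq h (fun k => ?_) ?_
  · push_cast
    rw [show 2 * π * ((k : ℝ) + 1) * (z / (2 * π)) = ((k : ℝ) + 1) * z by field_simp]
    ring
  · simp [Nat.factorial]
    field_simp
    ring

lemma hasSum_sin_mul_sin_div_sq {x y : ℝ} (hx : x ∈ Set.Icc 0 π) (hy : y ∈ Set.Icc 0 π) :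
    HasSum (fun k : ℕ => Real.sin (((k : ℝ) + 1) * x) * Real.sin (((k : ℝ) + 1) * y)
      / ((k : ℝ) + 1) ^ 2) ((π * min x y - x * y) / 2) := by
  wlog hxy : x ≤ y generalizing x y
  · have h := this hy hx (le_of_not_ge hxy)
    rw [min_comm, mul_comm x y]
    simpa only [mul_comm (Real.sin (_ * x))] using h
  have h1 := hasSum_cos_div_sq (z := y - x) (by linarith) (by linarith [hx.1, hy.2, pi_pos])
  have h2 := hasSum_cos_div_sq (z := x + y) (by linarith [hx.1, hy.1]) (by linarith [hx.2, hy.2])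
  refine hasSum_of_hasSum_of_eq ((h1.sub h2).mul_left (1 / 2)) (fun k => ?_) ?_
  · rw [mul_sub ((k : ℝ) + 1), mul_add ((k : ℝ) + 1), Real.cos_sub, Real.cos_add]
    ring
  · rw [min_eq_left hxy]
    ring

/-- The second difference of a two-variable function over the rectangle `[x, x'] × [y, y']`. -/
def rectDiff (C : ℝ → ℝ → ℝ) (x x' y y' : ℝ) : ℝ :=
  C x' y' - C x' y - C x y' + C x y

lemma summable_exp_neg_sq {c : ℝ} (hc : 0 < c) :
    Summable (fun k : ℕ => Real.exp (-(c * ((k : ℝ) + 1) ^ 2))) := by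
  have h : Summable (fun k : ℕ => Real.exp ((k : ℝ) * (-c))) :=
    Real.summable_exp_nat_mul_iff.2 (by linarith)
  refine h.of_nonneg_of_le (fun k => (Real.exp_pos _).le) fun k => Real.exp_le_exp.2 ?_
  have hk : (0 : ℝ) ≤ k := k.cast_nonneg
  nlinarith [mul_nonneg hc.le (sq_nonneg (k : ℝ)), mul_nonneg hc.le hk]

lemma summable_heatCovSpace {θ : ℝ} (σ : ℝ) {t : ℝ} (hθ : 0 < θ) (ht : 0 < t) (x y : ℝ) :
    Summable (fun k : ℕ => (σ ^ 2 / (θ * π * ((k : ℝ) + 1) ^ 2)) *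
      (1 - Real.exp (-(2 * θ * ((k : ℝ) + 1) ^ 2 * t))) *
      Real.sin (((k : ℝ) + 1) * x) * Real.sin (((k : ℝ) + 1) * y)) := by
  have h : Summable (fun k : ℕ => σ ^ 2 / (θ * π) * (1 / ((k : ℝ) + 1) ^ 2)) :=
    Summable.mul_left _ (by
      have := (summable_nat_add_iff 1).2 (Real.summable_one_div_nat_pow.2 one_lt_two)
      simpa using this)
  refine Summable.of_norm_bounded h fun k => ?_
  have he : Real.exp (-(2 * θ * ((k : ℝ) + 1) ^ 2 * t)) ≤ 1 :=
    Real.exp_le_one_iff.2 (by simp only [Left.neg_nonpos_iff]; positivity)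
  have he' := Real.exp_pos (-(2 * θ * ((k : ℝ) + 1) ^ 2 * t))
  rw [norm_mul, norm_mul, norm_mul, Real.norm_of_nonneg (by positivity),
    Real.norm_of_nonneg (sub_nonneg.2 he)]
  have e1 : σ ^ 2 / (θ * π * ((k : ℝ) + 1) ^ 2) = σ ^ 2 / (θ * π) * (1 / ((k : ℝ) + 1) ^ 2) := by
    field_simp
  rw [← e1, mul_assoc, mul_assoc]
  refine mul_le_of_le_one_right (by positivity) ?_
  refine mul_le_one₀ (by linarith) (by positivity) ?_
  exact mul_le_one₀ (Real.abs_sin_le_one _) (by positivity) (Real.abs_sin_le_one _)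

lemma heatCovSpace_comm (θ σ t x y : ℝ) : heatCovSpace θ σ t x y = heatCovSpace θ σ t y x := by
  unfold heatCovSpace
  exact tsum_congr fun k => by ring

lemma heatCovSpace_quadratic_nonneg {θ σ t : ℝ} (hθ : 0 < θ) (ht : 0 < t) {n : ℕ}
    (x a : Fin n → ℝ) : 0 ≤ ∑ i, ∑ j, a i * a j * heatCovSpace θ σ t (x i) (x j) := by
  have h : HasSum (fun k : ℕ => ∑ i, ∑ j, a i * a j * ((σ ^ 2 / (θ * π * ((k : ℝ) + 1) ^ 2)) *
      (1 - Real.exp (-(2 * θ * ((k : ℝ) + 1) ^ 2 * t))) *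
      Real.sin (((k : ℝ) + 1) * x i) * Real.sin (((k : ℝ) + 1) * x j)))
      (∑ i, ∑ j, a i * a j * heatCovSpace θ σ t (x i) (x j)) :=
    hasSum_sum fun i _ => hasSum_sum fun j _ =>
      (summable_heatCovSpace σ hθ ht (x i) (x j)).hasSum.mul_left _
  refine h.nonneg fun k => ?_
  have he : Real.exp (-(2 * θ * ((k : ℝ) + 1) ^ 2 * t)) ≤ 1 :=
    Real.exp_le_one_iff.2 (by simp only [Left.neg_nonpos_iff]; positivity)
  have hq : ∑ i, ∑ j, a i * a j * ((σ ^ 2 / (θ * π * ((k : ℝ) + 1) ^ 2)) *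
      (1 - Real.exp (-(2 * θ * ((k : ℝ) + 1) ^ 2 * t))) *
      Real.sin (((k : ℝ) + 1) * x i) * Real.sin (((k : ℝ) + 1) * x j))
      = (σ ^ 2 / (θ * π * ((k : ℝ) + 1) ^ 2)) *
      (1 - Real.exp (-(2 * θ * ((k : ℝ) + 1) ^ 2 * t))) *
        (∑ i, a i * Real.sin (((k : ℝ) + 1) * x i)) ^ 2 := by
    rw [sq (∑ i, _), Finset.sum_mul_sum, Finset.mul_sum]
    refine Finset.sum_congr rfl fun i _ => ?_
    rw [Finset.mul_sum]
    exact Finset.sum_congr rfl fun j _ => by ring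
  rw [hq]
  exact mul_nonneg (mul_nonneg (by positivity) (by linarith)) (sq_nonneg _)

lemma abs_sin_mul_sub_sin_mul_le {k : ℝ} (hk : 0 ≤ k) (x y : ℝ) :
    |Real.sin (k * x) - Real.sin (k * y)| ≤ k * |x - y| := by
  have h := Real.lipschitzWith_sin.dist_le_mul (k * x) (k * y)
  simpa [Real.dist_eq, ← mul_sub, abs_mul, abs_of_nonneg hk] using h

/-- Up to a remainder of the order of the area, the covariance of two increments of the field
is that of a Brownian motion of variance `σ² / (2θ)` per unit of length. -/
lemma abs_rectDiff_heatCovSpace_sub_le {θ σ t : ℝ} (hθ : 0 < θ) (ht : 0 < t)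
    {x x' y y' : ℝ} (hx : x ∈ Set.Icc 0 π) (hx' : x' ∈ Set.Icc 0 π)
    (hy : y ∈ Set.Icc 0 π) (hy' : y' ∈ Set.Icc 0 π) :
    |rectDiff (heatCovSpace θ σ t) x x' y y' - σ ^ 2 / (2 * θ) * rectDiff min x x' y y'|
      ≤ σ ^ 2 / (θ * π) * (1 / 2 + ∑' k : ℕ, Real.exp (-(2 * θ * t * ((k : ℝ) + 1) ^ 2)))
        * (|x' - x| * |y' - y|) := by
  set e : ℕ → ℝ := fun k => Real.exp (-(2 * θ * t * ((k : ℝ) + 1) ^ 2)) with he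
  have hes : Summable e := summable_exp_neg_sq (by positivity)
  set s : ℕ → ℝ → ℝ := fun k z => Real.sin (((k : ℝ) + 1) * z) with hs
  set r : ℕ → ℝ := fun k => e k * ((s k x' - s k x) * (s k y' - s k y) / ((k : ℝ) + 1) ^ 2) with hr
  have hrb : ∀ k, ‖r k‖ ≤ e k * (|x' - x| * |y' - y|) := by
    intro k
    have hk : (0 : ℝ) < (k : ℝ) + 1 := by positivity
    rw [hr]
    simp only [norm_mul, norm_div, Real.norm_eq_abs]
    rw [abs_of_pos (Real.exp_pos _ : 0 < e k)]
    refine mul_le_mul_of_nonneg_left ?_ (Real.exp_pos _).le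
    rw [abs_of_pos (show 0 < ((k : ℝ) + 1) ^ 2 by positivity), div_le_iff₀ (by positivity)]
    calc |s k x' - s k x| * |s k y' - s k y|
        ≤ (((k : ℝ) + 1) * |x' - x|) * (((k : ℝ) + 1) * |y' - y|) :=
          mul_le_mul (abs_sin_mul_sub_sin_mul_le hk.le _ _) (abs_sin_mul_sub_sin_mul_le hk.le _ _)
            (abs_nonneg _) (by positivity)
      _ = _ := by ring
  have hrs : Summable r := Summable.of_norm_bounded (hes.mul_right _) hrb
  have hR : |∑' k, r k| ≤ (∑' k, e k) * (|x' - x| * |y' - y|) := by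
    have := tsum_of_norm_bounded (hes.hasSum.mul_right (|x' - x| * |y' - y|)) hrb
    simpa using this
  have hG : HasSum (fun k => σ ^ 2 / (θ * π) *
      ((s k x' - s k x) * (s k y' - s k y) / ((k : ℝ) + 1) ^ 2 - r k))
      (rectDiff (heatCovSpace θ σ t) x x' y y') := by
    have h := fun z w => (summable_heatCovSpace σ hθ ht z w).hasSum
    refine hasSum_of_hasSum_of_eq ((((h x' y').sub (h x' y)).sub (h x y')).add (h x y))
      (fun k => ?_) rfl
    have hk : ((k : ℝ) + 1) ≠ 0 := by positivity
    have e1 : σ ^ 2 / (θ * π * ((k : ℝ) + 1) ^ 2) = σ ^ 2 / (θ * π) * (1 / ((k : ℝ) + 1) ^ 2) := by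
      field_simp
    have e2 : 2 * θ * ((k : ℝ) + 1) ^ 2 * t = 2 * θ * t * ((k : ℝ) + 1) ^ 2 := by ring
    rw [e1, e2]
    simp only [hr, hs, he]
    ring
  have hM : HasSum (fun k => (s k x' - s k x) * (s k y' - s k y) / ((k : ℝ) + 1) ^ 2)
      (π / 2 * rectDiff min x x' y y' - (x' - x) * (y' - y) / 2) := by
    have h := ((((hasSum_sin_mul_sin_div_sq hx' hy').sub (hasSum_sin_mul_sin_div_sq hx' hy)).sub
      (hasSum_sin_mul_sin_div_sq hx hy')).add (hasSum_sin_mul_sin_div_sq hx hy))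
    refine hasSum_of_hasSum_of_eq h (fun k => ?_) ?_
    · simp only [hs]
      ring
    · simp only [rectDiff]
      ring
  have hval := hG.unique ((hM.sub hrs.hasSum).mul_left (σ ^ 2 / (θ * π)))
  have hdiff : rectDiff (heatCovSpace θ σ t) x x' y y' - σ ^ 2 / (2 * θ) * rectDiff min x x' y y'
      = -(σ ^ 2 / (θ * π) * ((x' - x) * (y' - y) / 2 + ∑' k, r k)) := by
    rw [hval]
    field_simp
    ring
  rw [hdiff, abs_neg, abs_mul, abs_of_nonneg (by positivity : 0 ≤ σ ^ 2 / (θ * π)), mul_assoc]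
  refine mul_le_mul_of_nonneg_left ?_ (by positivity)
  calc |(x' - x) * (y' - y) / 2 + ∑' k, r k|
      ≤ |(x' - x) * (y' - y) / 2| + |∑' k, r k| := abs_add_le _ _
    _ = |x' - x| * |y' - y| / 2 + |∑' k, r k| := by rw [abs_div, abs_mul, abs_two]
    _ ≤ _ := by linarith

lemma map_increments_eq_gaussianReal {Ω : Type*} [MeasurableSpace Ω] {P : Measure Ω}
    {θ σ t : ℝ} (hθ : 0 < θ) (ht : 0 < t) {u : ℝ → Ω → ℝ}
    (hu : IsCenteredGaussianField P u (Set.Icc 0 π) (heatCovSpace θ σ t))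
    {x x' y y' : ℝ} (hx : x ∈ Set.Icc 0 π) (hx' : x' ∈ Set.Icc 0 π)
    (hy : y ∈ Set.Icc 0 π) (hy' : y' ∈ Set.Icc 0 π) (α β : ℝ) :
    ∃ v : NNReal, (v : ℝ) = α ^ 2 * rectDiff (heatCovSpace θ σ t) x x' x x'
        + 2 * α * β * rectDiff (heatCovSpace θ σ t) x x' y y'
        + β ^ 2 * rectDiff (heatCovSpace θ σ t) y y' y y' ∧
      P.map (fun ω => α * (u x' ω - u x ω) + β * (u y' ω - u y ω)) = gaussianReal 0 v := by
  have hmem : ∀ i, ![x, x', y, y'] i ∈ Set.Icc 0 π := by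
    intro i
    fin_cases i <;> assumption
  have h := hu 4 ![x, x', y, y'] hmem ![-α, α, -β, β]
  have hn := heatCovSpace_quadratic_nonneg (σ := σ) hθ ht ![x, x', y, y'] ![-α, α, -β, β]
  refine ⟨_, ?_, Eq.trans ?_ h⟩
  · rw [Real.coe_toNNReal _ hn]
    simp only [Fin.sum_univ_four, Matrix.cons_val, rectDiff]
    rw [heatCovSpace_comm θ σ t x' x, heatCovSpace_comm θ σ t y' y, heatCovSpace_comm θ σ t y x,
      heatCovSpace_comm θ σ t y x', heatCovSpace_comm θ σ t y' x, heatCovSpace_comm θ σ t y' x']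
    ring
  · congr 1
    ext ω
    simp only [Fin.sum_univ_four, Matrix.cons_val]
    ring

lemma integral_pow_four_gaussianReal (v : NNReal) :
    ∫ x, x ^ 4 ∂gaussianReal 0 v = 3 * (v : ℝ) ^ 2 := by
  have h := iteratedDeriv_mgf_zero (X := fun x : ℝ => x) (μ := gaussianReal 0 v)
    (by simp [integrableExpSet_fun_id_gaussianReal]) 4
  rw [mgf_fun_id_gaussianReal] at h
  have hE : (fun x : ℝ => x ^ 4) = ((fun x : ℝ => x) ^ 4 : ℝ → ℝ) := rfl
  rw [hE, ← h]
  generalize (v : ℝ) = c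
  have hd : ∀ p p' : ℝ → ℝ, (∀ s, HasDerivAt p (p' s) s) →
      deriv (fun s => p s * rexp (0 * s + c * s ^ 2 / 2))
        = fun s => (p' s + p s * (c * s)) * rexp (0 * s + c * s ^ 2 / 2) := by
    intro p p' hp
    ext s
    have h1 : HasDerivAt (fun s : ℝ => 0 * s + c * s ^ 2 / 2) (c * s) s := by
      refine (((hasDerivAt_id s).const_mul 0).add
        ((((hasDerivAt_id s).pow 2).const_mul c).div_const 2)).congr_deriv ?_
      simp
      ring
    have h2 : HasDerivAt (fun s => p s * rexp (0 * s + c * s ^ 2 / 2)) _ s := (hp s).mul h1.exp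
    rw [h2.deriv]
    ring
  have e1 : deriv (fun s => rexp (0 * s + c * s ^ 2 / 2))
      = fun s => (c * s) * rexp (0 * s + c * s ^ 2 / 2) := by
    have := hd (fun _ => 1) (fun _ => 0) fun s => hasDerivAt_const s 1
    simpa using this
  have e2 := hd (fun s => c * s) (fun _ => c) fun s => by
    simpa using (hasDerivAt_id s).const_mul c
  have e3 := hd (fun s => c + c * s * (c * s)) (fun s => 2 * c ^ 2 * s) fun s => by
    have := (((hasDerivAt_id s).pow 2).const_mul (c ^ 2)).const_add c
    refine (this.congr_deriv ?_).congr_of_eventuallyEq (Eventually.of_forall fun z => ?_)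
    · simp
      ring
    · simp
      ring
  have e4 := hd (fun s => 2 * c ^ 2 * s + (c + c * s * (c * s)) * (c * s))
      (fun s => 3 * c ^ 2 + 3 * c ^ 3 * s ^ 2) fun s => by
    have := ((hasDerivAt_id s).const_mul (3 * c ^ 2)).add
      (((hasDerivAt_id s).pow 3).const_mul (c ^ 3))
    refine (this.congr_deriv ?_).congr_of_eventuallyEq (Eventually.of_forall fun z => ?_)
    · simp
      ring
    · simp
      ring
  rw [iteratedDeriv_succ, iteratedDeriv_succ, iteratedDeriv_succ, iteratedDeriv_one, e1, e2, e3, e4]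
  simp

lemma integral_sq_gaussianReal (v : NNReal) : ∫ x, x ^ 2 ∂gaussianReal 0 v = v := by
  have h := variance_fun_id_gaussianReal (μ := 0) (v := v)
  rw [variance_eq_integral (by fun_prop), integral_id_gaussianReal] at h
  simpa using h

lemma integrable_pow_gaussianReal (v : NNReal) (n : ℕ) :
    Integrable (fun x => x ^ n) (gaussianReal 0 v) := by
  have h := memLp_id_gaussianReal (μ := 0) (v := v) n
  have h' := h.integrable_norm_pow'
  refine (integrable_norm_iff (by fun_prop)).1 (h'.congr (Eventually.of_forall fun x => ?_))
  simp

section GaussianMoments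

variable {Ω : Type*} [MeasurableSpace Ω] {P : Measure Ω}

lemma aemeasurable_of_map_eq_gaussianReal {X : Ω → ℝ} {v : NNReal}
    (h : P.map X = gaussianReal 0 v) : AEMeasurable X P :=
  AEMeasurable.of_map_ne_zero (by rw [h]; exact IsProbabilityMeasure.ne_zero _)

lemma integrable_pow_of_map_eq_gaussianReal {X : Ω → ℝ} {v : NNReal}
    (h : P.map X = gaussianReal 0 v) (n : ℕ) : Integrable (fun ω => X ω ^ n) P := by
  have hX := aemeasurable_of_map_eq_gaussianReal h
  have := integrable_pow_gaussianReal v n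
  rw [← h] at this
  exact this.comp_aemeasurable hX

lemma integral_pow_of_map_eq_gaussianReal {X : Ω → ℝ} {v : NNReal}
    (h : P.map X = gaussianReal 0 v) (n : ℕ) :
    ∫ ω, X ω ^ n ∂P = ∫ x, x ^ n ∂gaussianReal 0 v := by
  rw [← h, integral_map (aemeasurable_of_map_eq_gaussianReal h) (by fun_prop)]

/-- The Isserlis formula `E[X²Y²] = E[X²] E[Y²] + 2 E[XY]²` for a centered Gaussian pair. -/
lemma integral_sq_mul_sq_of_gaussian {X Y : Ω → ℝ} {a b c : ℝ}
    (h : ∀ α β : ℝ, ∃ v : NNReal, (v : ℝ) = α ^ 2 * a + 2 * α * β * c + β ^ 2 * b ∧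
      P.map (fun ω => α * X ω + β * Y ω) = gaussianReal 0 v) :
    Integrable (fun ω => X ω ^ 2 * Y ω ^ 2) P ∧
      ∫ ω, X ω ^ 2 * Y ω ^ 2 ∂P = a * b + 2 * c ^ 2 := by
  obtain ⟨v1, e1, h1⟩ := h 1 0
  obtain ⟨v2, e2, h2⟩ := h 0 1
  obtain ⟨v3, e3, h3⟩ := h 1 1
  obtain ⟨v4, e4, h4⟩ := h 1 (-1)
  have hid : (fun ω => X ω ^ 2 * Y ω ^ 2) = fun ω => (1 / 12) *
      ((1 * X ω + 1 * Y ω) ^ 4 + (1 * X ω + (-1) * Y ω) ^ 4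
        - 2 * (1 * X ω + 0 * Y ω) ^ 4 - 2 * (0 * X ω + 1 * Y ω) ^ 4) := by
    ext ω
    ring
  have i1 := integrable_pow_of_map_eq_gaussianReal h1 4
  have i2 := integrable_pow_of_map_eq_gaussianReal h2 4
  have i3 := integrable_pow_of_map_eq_gaussianReal h3 4
  have i4 := integrable_pow_of_map_eq_gaussianReal h4 4
  have i34 : Integrable (fun ω => (1 * X ω + 1 * Y ω) ^ 4 + (1 * X ω + (-1) * Y ω) ^ 4) P :=
    i3.add i4
  have i341 : Integrable (fun ω => (1 * X ω + 1 * Y ω) ^ 4 + (1 * X ω + (-1) * Y ω) ^ 4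
      - 2 * (1 * X ω + 0 * Y ω) ^ 4) P := i34.sub (i1.const_mul 2)
  rw [hid]
  refine ⟨(i341.sub (i2.const_mul 2)).const_mul _, ?_⟩
  rw [integral_const_mul, integral_sub i341 (i2.const_mul 2),
    integral_sub i34 (i1.const_mul 2), integral_add i3 i4, integral_const_mul,
    integral_const_mul,
    integral_pow_of_map_eq_gaussianReal h1, integral_pow_of_map_eq_gaussianReal h2,
    integral_pow_of_map_eq_gaussianReal h3, integral_pow_of_map_eq_gaussianReal h4]
  simp only [integral_pow_four_gaussianReal, e1, e2, e3, e4]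
  ring

/-- Mean square deviation of a sum of squares of jointly Gaussian centered variables from a
constant. -/
lemma integral_sum_sq_sub_sq_of_gaussian [IsProbabilityMeasure P] {m : ℕ} {D : ℕ → Ω → ℝ} {c : ℕ → ℕ → ℝ} (L : ℝ)
    (h : ∀ i ∈ Finset.range m, ∀ j ∈ Finset.range m, ∀ α β : ℝ, ∃ v : NNReal,
      (v : ℝ) = α ^ 2 * c i i + 2 * α * β * c i j + β ^ 2 * c j j ∧
      P.map (fun ω => α * D i ω + β * D j ω) = gaussianReal 0 v) :
    Integrable (fun ω => (∑ j ∈ Finset.range m, D j ω ^ 2 - L) ^ 2) P ∧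
      ∫ ω, (∑ j ∈ Finset.range m, D j ω ^ 2 - L) ^ 2 ∂P
        = (∑ j ∈ Finset.range m, c j j - L) ^ 2
          + 2 * ∑ i ∈ Finset.range m, ∑ j ∈ Finset.range m, c i j ^ 2 := by
  have h2 : ∀ j ∈ Finset.range m, Integrable (fun ω => D j ω ^ 2) P ∧
      ∫ ω, D j ω ^ 2 ∂P = c j j := by
    intro j hj
    obtain ⟨v, e, hv⟩ := h j hj j hj 1 0
    have hv' : P.map (D j) = gaussianReal 0 v := by simpa using hv
    refine ⟨integrable_pow_of_map_eq_gaussianReal hv' 2, ?_⟩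
    rw [integral_pow_of_map_eq_gaussianReal hv', integral_sq_gaussianReal, e]
    ring
  have h4 := fun i hi j hj => integral_sq_mul_sq_of_gaussian (h i hi j hj)
  have hid : (fun ω => (∑ j ∈ Finset.range m, D j ω ^ 2 - L) ^ 2) = fun ω =>
      (∑ i ∈ Finset.range m, ∑ j ∈ Finset.range m, D i ω ^ 2 * D j ω ^ 2)
        - 2 * L * (∑ j ∈ Finset.range m, D j ω ^ 2) + L ^ 2 := by
    ext ω
    rw [← Finset.sum_mul_sum]
    ring
  have iA : Integrable (fun ω => ∑ i ∈ Finset.range m, ∑ j ∈ Finset.range m,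
      D i ω ^ 2 * D j ω ^ 2) P :=
    integrable_finsetSum _ fun i hi => integrable_finsetSum _ fun j hj => (h4 i hi j hj).1
  have iB : Integrable (fun ω => 2 * L * ∑ j ∈ Finset.range m, D j ω ^ 2) P :=
    (integrable_finsetSum _ fun j hj => (h2 j hj).1).const_mul _
  have iAB : Integrable (fun ω => (∑ i ∈ Finset.range m, ∑ j ∈ Finset.range m,
      D i ω ^ 2 * D j ω ^ 2) - 2 * L * ∑ j ∈ Finset.range m, D j ω ^ 2) P := iA.sub iB
  rw [hid]
  refine ⟨iAB.add (integrable_const _), ?_⟩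
  rw [integral_add iAB (integrable_const _), integral_sub iA iB, integral_const_mul,
    integral_finsetSum _ (fun j hj => (h2 j hj).1),
    integral_finsetSum _ (fun i hi => integrable_finsetSum _ fun j hj => (h4 i hi j hj).1),
    Finset.sum_congr rfl fun j hj => (h2 j hj).2,
    Finset.sum_congr rfl fun i hi => (integral_finsetSum _ fun j hj => (h4 i hi j hj).1).trans
      (Finset.sum_congr rfl fun j hj => (h4 i hi j hj).2)]
  simp only [Finset.sum_add_distrib, ← Finset.mul_sum, integral_const, probReal_univ, one_smul]
  rw [← Finset.sum_mul]
  ring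

end GaussianMoments

lemma rectDiff_min_self {x x' : ℝ} (h : x ≤ x') : rectDiff min x x' x x' = x' - x := by
  simp [rectDiff, h]

lemma rectDiff_min_of_le_left {x x' y y' : ℝ} (hx : x ≤ x') (hy : y ≤ y') (h : x' ≤ y) :
    rectDiff min x x' y y' = 0 := by
  simp [rectDiff, h, h.trans hy, hx.trans h, (hx.trans h).trans hy]

lemma rectDiff_min_of_le_right {x x' y y' : ℝ} (hx : x ≤ x') (hy : y ≤ y') (h : y' ≤ x) :
    rectDiff min x x' y y' = 0 := by
  simp [rectDiff, h, h.trans hx, hy.trans h, (hy.trans h).trans hx]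

/-- If a covariance matrix of size `m` differs from `s (ℓ / m)` times the identity by
`O((ℓ / m)²)` entrywise, then the mean square deviation of the associated sum of squares
from `s ℓ` is `O(1 / m)`. -/
lemma sum_diag_sub_sq_add_le {m : ℕ} (hm : 1 ≤ m) {c : ℕ → ℕ → ℝ} {s ℓ K : ℝ}
    (h : ∀ i ∈ Finset.range m, ∀ j ∈ Finset.range m,
      |c i j - (if i = j then s * (ℓ / m) else 0)| ≤ K * (ℓ / m) ^ 2) :
    (∑ j ∈ Finset.range m, c j j - s * ℓ) ^ 2
      + 2 * ∑ i ∈ Finset.range m, ∑ j ∈ Finset.range m, c i j ^ 2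
      ≤ (5 * K ^ 2 * ℓ ^ 4 + 4 * s ^ 2 * ℓ ^ 2) / m := by
  have hm' : (1 : ℝ) ≤ m := by exact_mod_cast hm
  have hm0 : (0 : ℝ) < m := by linarith
  have hdiag : |∑ j ∈ Finset.range m, c j j - s * ℓ| ≤ m * (K * (ℓ / m) ^ 2) := by
    have e : ∑ j ∈ Finset.range m, c j j - s * ℓ
        = ∑ j ∈ Finset.range m, (c j j - s * (ℓ / m)) := by
      rw [Finset.sum_sub_distrib, Finset.sum_const, Finset.card_range, nsmul_eq_mul]
      field_simp
    rw [e]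
    refine (Finset.abs_sum_le_sum_abs _ _).trans ?_
    refine (Finset.sum_le_sum fun j hj => ?_).trans_eq
      (by rw [Finset.sum_const, Finset.card_range, nsmul_eq_mul])
    simpa using h j hj j hj
  have hentry : ∀ i ∈ Finset.range m, ∀ j ∈ Finset.range m,
      c i j ^ 2 ≤ (if i = j then 2 * (s * (ℓ / m)) ^ 2 else 0) + 2 * (K * (ℓ / m) ^ 2) ^ 2 := by
    intro i hi j hj
    have h1 := sq_le_sq' (abs_le.1 (h i hi j hj)).1 (abs_le.1 (h i hi j hj)).2
    split_ifs at h1 ⊢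
    · nlinarith [sq_nonneg (c i j - 2 * (s * (ℓ / m)))]
    · nlinarith [sq_nonneg (K * (ℓ / m) ^ 2)]
  have hall : ∑ i ∈ Finset.range m, ∑ j ∈ Finset.range m, c i j ^ 2
      ≤ m * (2 * (s * (ℓ / m)) ^ 2) + m * (m * (2 * (K * (ℓ / m) ^ 2) ^ 2)) := by
    refine (Finset.sum_le_sum fun i hi => Finset.sum_le_sum fun j hj =>
      hentry i hi j hj).trans_eq ?_
    simp only [Finset.sum_add_distrib, Finset.sum_ite_eq, Finset.sum_const, Finset.card_range,
      nsmul_eq_mul]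
    rw [Finset.sum_congr rfl fun i hi => if_pos hi, Finset.sum_const, Finset.card_range,
      nsmul_eq_mul]
  have hsq := sq_le_sq' (abs_le.1 hdiag).1 (abs_le.1 hdiag).2
  have hfin : (m * (K * (ℓ / m) ^ 2)) ^ 2
      + 2 * (m * (2 * (s * (ℓ / m)) ^ 2) + m * (m * (2 * (K * (ℓ / m) ^ 2) ^ 2)))
      = 5 * K ^ 2 * ℓ ^ 4 / m / m + 4 * s ^ 2 * ℓ ^ 2 / m := by
    field_simp
    ring
  have hdiv : 5 * K ^ 2 * ℓ ^ 4 / m / m ≤ 5 * K ^ 2 * ℓ ^ 4 / m :=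
    div_le_self (by positivity) hm'
  rw [add_div]
  linarith

lemma tendstoInMeasure_const_of_integral_sq_le {Ω : Type*} [MeasurableSpace Ω] {P : Measure Ω}
    [IsFiniteMeasure P] {V : ℕ → Ω → ℝ} {L B : ℝ}
    (h : ∀ m : ℕ, 1 ≤ m → Integrable (fun ω => (V m ω - L) ^ 2) P ∧
      ∫ ω, (V m ω - L) ^ 2 ∂P ≤ B / m) :
    TendstoInMeasure P V atTop (fun _ => L) := by
  rw [tendstoInMeasure_iff_measureReal_dist]
  intro ε hε
  have hlim : Tendsto (fun m : ℕ => B / (m : ℝ) / ε ^ 2) atTop (nhds 0) := by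
    simpa using (tendsto_const_div_atTop_nhds_zero_nat B).div_const (ε ^ 2)
  refine squeeze_zero' (Eventually.of_forall fun m => measureReal_nonneg) ?_ hlim
  filter_upwards [eventually_ge_atTop 1] with m hm
  obtain ⟨hi, hb⟩ := h m hm
  have hM := mul_meas_ge_le_integral_of_nonneg
    (Eventually.of_forall fun ω => sq_nonneg (V m ω - L)) hi (ε ^ 2)
  have hset : {ω | ε ≤ dist (V m ω) L} = {ω | ε ^ 2 ≤ (V m ω - L) ^ 2} := by
    ext ω
    simp only [Set.mem_ofPred_eq, Real.dist_eq]
    rw [sq_le_sq, abs_of_pos hε]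
  rw [hset, le_div_iff₀ (by positivity), mul_comm]
  exact hM.trans hb

lemma tendstoInMeasure_comp_continuousAt_const {Ω : Type*} [MeasurableSpace Ω] {P : Measure Ω}
    {V : ℕ → Ω → ℝ} {L : ℝ} (h : TendstoInMeasure P V atTop (fun _ => L))
    {g : ℝ → ℝ} (hg : ContinuousAt g L) :
    TendstoInMeasure P (fun m ω => g (V m ω)) atTop (fun _ => g L) := by
  rw [tendstoInMeasure_iff_dist] at h ⊢
  intro ε hε
  obtain ⟨δ, hδ, hgδ⟩ := Metric.continuousAt_iff.1 hg ε hε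
  refine tendsto_of_tendsto_of_tendsto_of_le_of_le tendsto_const_nhds (h δ hδ)
    (fun m => zero_le) fun m => measure_mono fun ω hω => ?_
  by_contra hlt
  exact absurd hω (not_le.2 (hgδ (not_le.1 hlt)))

lemma grid_mem_Icc {a b s m : ℝ} (ha : 0 ≤ a) (hab : a < b) (hb : b ≤ π) (hm : 0 < m)
    (hs : 0 ≤ s) (hsm : s ≤ m) : a + (b - a) * s / m ∈ Set.Icc 0 π := by
  have hba : 0 < b - a := by linarith
  have h1 : 0 ≤ (b - a) * s / m := by positivity
  have h2 : (b - a) * s / m ≤ b - a := by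
    rw [div_le_iff₀ hm]
    exact mul_le_mul_of_nonneg_left hsm hba.le
  exact ⟨by linarith, by linarith⟩

/-- Mean square rate of convergence of the spatial quadratic variation. -/
lemma exists_integral_quadraticVariation_sub_sq_le {Ω : Type*} [MeasurableSpace Ω]
    {P : Measure Ω} [IsProbabilityMeasure P]
    {θ σ t a b : ℝ} (hθ : 0 < θ) (ht : 0 < t) (ha : 0 ≤ a) (hab : a < b) (hb : b ≤ π)
    {u : ℝ → Ω → ℝ}
    (hu : IsCenteredGaussianField P u (Set.Icc 0 π) (heatCovSpace θ σ t)) :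
    ∃ B : ℝ, ∀ m : ℕ, 1 ≤ m →
      Integrable (fun ω => (∑ j ∈ Finset.range m,
          (u (a + (b - a) * ((j : ℝ) + 1) / (m : ℝ)) ω
            - u (a + (b - a) * (j : ℝ) / (m : ℝ)) ω) ^ 2 - σ ^ 2 / (2 * θ) * (b - a)) ^ 2) P ∧
        ∫ ω, (∑ j ∈ Finset.range m,
          (u (a + (b - a) * ((j : ℝ) + 1) / (m : ℝ)) ω
            - u (a + (b - a) * (j : ℝ) / (m : ℝ)) ω) ^ 2 - σ ^ 2 / (2 * θ) * (b - a)) ^ 2 ∂P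
          ≤ B / m := by
  obtain ⟨K, hK⟩ : ∃ K : ℝ, K = σ ^ 2 / (θ * π) *
    (1 / 2 + ∑' k : ℕ, Real.exp (-(2 * θ * t * ((k : ℝ) + 1) ^ 2))) := ⟨_, rfl⟩
  refine ⟨5 * K ^ 2 * (b - a) ^ 4 + 4 * (σ ^ 2 / (2 * θ)) ^ 2 * (b - a) ^ 2, fun m hm => ?_⟩
  have hm0 : (0 : ℝ) < m := by exact_mod_cast hm
  have hba : 0 < b - a := by linarith
  obtain ⟨x, hx⟩ : ∃ x : ℝ → ℝ, ∀ s, x s = a + (b - a) * s / m := ⟨_, fun _ => rfl⟩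
  simp only [← hx]
  have hmono : Monotone x := fun s r hsr => by
    simp only [hx]
    gcongr
  have hstep : ∀ s, x (s + 1) - x s = (b - a) / m := fun s => by
    simp only [hx]
    ring
  have hstep_abs : ∀ s, |x (s + 1) - x s| = (b - a) / m := fun s => by
    rw [hstep, abs_of_pos (by positivity)]
  have hmem : ∀ j ∈ Finset.range m, x j ∈ Set.Icc 0 π ∧ x (j + 1) ∈ Set.Icc 0 π := by
    intro j hj
    have hj' : (j : ℝ) + 1 ≤ m := by exact_mod_cast Finset.mem_range.1 hj
    rw [hx, hx]
    exact ⟨grid_mem_Icc ha hab hb hm0 (by positivity) (by linarith),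
      grid_mem_Icc ha hab hb hm0 (by positivity) hj'⟩
  obtain ⟨hint, heq⟩ := integral_sum_sq_sub_sq_of_gaussian (P := P) (m := m)
    (D := fun j ω => u (x (j + 1)) ω - u (x j) ω)
    (c := fun i j => rectDiff (heatCovSpace θ σ t) (x i) (x (i + 1)) (x j) (x (j + 1)))
    (σ ^ 2 / (2 * θ) * (b - a)) fun i hi j hj α β =>
      map_increments_eq_gaussianReal hθ ht hu (hmem i hi).1 (hmem i hi).2 (hmem j hj).1
        (hmem j hj).2 α β
  refine ⟨hint, heq.trans_le (sum_diag_sub_sq_add_le hm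
    (c := fun i j => rectDiff (heatCovSpace θ σ t) (x i) (x (i + 1)) (x j) (x (j + 1)))
    (s := σ ^ 2 / (2 * θ)) (ℓ := b - a) (K := K) fun i hi j hj => ?_)⟩
  have hbound := abs_rectDiff_heatCovSpace_sub_le (σ := σ) hθ ht (hmem i hi).1 (hmem i hi).2
    (hmem j hj).1 (hmem j hj).2
  have hmin : rectDiff min (x i) (x (i + 1)) (x j) (x (j + 1))
      = if i = j then (b - a) / m else 0 := by
    have hxi : x i ≤ x (i + 1) := hmono (by linarith)
    have hxj : x j ≤ x (j + 1) := hmono (by linarith)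
    rcases lt_trichotomy i j with hij | rfl | hij
    · rw [if_neg hij.ne]
      exact rectDiff_min_of_le_left hxi hxj (hmono (by exact_mod_cast hij))
    · rw [if_pos rfl, rectDiff_min_self hxi, hstep]
    · rw [if_neg hij.ne']
      exact rectDiff_min_of_le_right hxi hxj (hmono (by exact_mod_cast hij))
  rw [hmin, hstep_abs, hstep_abs, ← sq, mul_ite, mul_zero, ← hK] at hbound
  exact hbound

/-- Consistency in probability of the drift estimator `θ̂_{m,t}` built from the spatial
quadratic variation of the stochastic heat equation observed at a fixed time `t` on the
uniform grid of `[a,b] ⊂ [0,π]`. -/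
theorem stmt11 {Ω : Type*} [MeasurableSpace Ω] (P : Measure Ω) [IsProbabilityMeasure P]
    (θ σ t a b : ℝ) (hθ : 0 < θ) (hσ : 0 < σ) (ht : 0 < t)
    (ha : 0 ≤ a) (hab : a < b) (hb : b ≤ π)
    (u : ℝ → Ω → ℝ)
    (hu : IsCenteredGaussianField P u (Set.Icc 0 π) (heatCovSpace θ σ t)) :
    TendstoInMeasure P
      (fun (m : ℕ) ω => (b - a) * σ ^ 2 /
        (2 * ∑ j ∈ Finset.range m,
          (u (a + (b - a) * ((j : ℝ) + 1) / (m : ℝ)) ω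
            - u (a + (b - a) * (j : ℝ) / (m : ℝ)) ω) ^ 2))
      atTop (fun _ => θ) := by
  obtain ⟨B, hB⟩ := exists_integral_quadraticVariation_sub_sq_le hθ ht ha hab hb hu
  have hba : 0 < b - a := by linarith
  have hL : σ ^ 2 / (2 * θ) * (b - a) ≠ 0 := by positivity
  have hg : ContinuousAt (fun v : ℝ => (b - a) * σ ^ 2 / (2 * v)) (σ ^ 2 / (2 * θ) * (b - a)) :=
    continuousAt_const.div (continuousAt_const.mul continuousAt_id) (mul_ne_zero two_ne_zero hL)
  have h := tendstoInMeasure_comp_continuousAt_const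
    (tendstoInMeasure_const_of_integral_sq_le hB) hg
  have hval : (b - a) * σ ^ 2 / (2 * (σ ^ 2 / (2 * θ) * (b - a))) = θ := by
    field_simp
  simpa only [hval] using h
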